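/- Suppose condition (⋆⋆) holds and g is a simple graph on {1,…,n} with η_i(g) = k_i for every firm i. Then for every edge ij of g, Y_i(g − ij) ≤ Y_i(g); that is, no firm can increase its total profit across the spatial markets by deleting one of its collaboration links. -/

import Mathlib

open Finset

noncomputable def degree' {n : ℕ} (g : SimpleGraph (Fin n)) (i : Fin n) : ℕ :=
  Nat.card {j | g.Adj i j}

/-- The graph `g` with the edge `ij` deleted. -/
def delE {n : ℕ} (g : SimpleGraph (Fin n)) (i j : Fin n) : SimpleGraph (Fin n) :=
  g.deleteEdges {s(i, j)}

/-- The graph `g` with the edge `ij` added. -/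
def addE {n : ℕ} (g : SimpleGraph (Fin n)) (i j : Fin n) : SimpleGraph (Fin n) :=
  g ⊔ SimpleGraph.fromEdgeSet {s(i, j)}

/-- Marginal production cost of firm `i` under collaboration graph `g`. -/
noncomputable def cost {n : ℕ} (γ₀ : ℝ) (f : ℝ → ℝ) (k : Fin n → ℕ)
    (g : SimpleGraph (Fin n)) (i : Fin n) : ℝ :=
  γ₀ + f ((degree' g i : ℝ) - (k i : ℝ))

/-- Cournot equilibrium quantity shipped by firm `i` to market node `l`
under collaboration graph `g`. -/
noncomputable def dq {n : ℕ} {V : Type*} [Fintype V] (αl : V → ℝ) (γ₀ : ℝ)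
    (s : V → Fin n → ℝ) (f : ℝ → ℝ) (k : Fin n → ℕ)
    (g : SimpleGraph (Fin n)) (l : V) (i : Fin n) : ℝ :=
  (αl l - γ₀ - n * (s l i + f ((degree' g i : ℝ) - (k i : ℝ)))
    + ∑ j ∈ univ.erase i, (s l j + f ((degree' g j : ℝ) - (k j : ℝ)))) / (n + 1)

/-- Price at market node `l` under collaboration graph `g`. -/
noncomputable def priceAt {n : ℕ} {V : Type*} [Fintype V] (αl : V → ℝ) (γ₀ : ℝ)
    (s : V → Fin n → ℝ) (f : ℝ → ℝ) (k : Fin n → ℕ)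
    (g : SimpleGraph (Fin n)) (l : V) : ℝ :=
  αl l - ∑ i, dq αl γ₀ s f k g l i

/-- Profit of firm `i` at market node `l` under collaboration graph `g`. -/
noncomputable def profitAt {n : ℕ} {V : Type*} [Fintype V] (αl : V → ℝ) (γ₀ : ℝ)
    (s : V → Fin n → ℝ) (f : ℝ → ℝ) (k : Fin n → ℕ)
    (g : SimpleGraph (Fin n)) (l : V) (i : Fin n) : ℝ :=
  dq αl γ₀ s f k g l i * (priceAt αl γ₀ s f k g l - cost γ₀ f k g i - s l i)

/-- Total profit of firm `i` across all spatial markets under collaboration graph `g`. -/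
noncomputable def totProfit {n : ℕ} {V : Type*} [Fintype V] (αl : V → ℝ) (γ₀ : ℝ)
    (s : V → Fin n → ℝ) (f : ℝ → ℝ) (k : Fin n → ℕ)
    (g : SimpleGraph (Fin n)) (i : Fin n) : ℝ :=
  ∑ l, profitAt αl γ₀ s f k g l i

theorem degree'_delE_left {n : ℕ} {g : SimpleGraph (Fin n)} {i j : Fin n} (hij : g.Adj i j) :
    degree' (delE g i j) i + 1 = degree' g i := by
  have hset : {m | (delE g i j).Adj i m} = {m | g.Adj i m} \ {j} := by
    ext m
    simp only [delE, SimpleGraph.deleteEdges_adj, Set.mem_ofPred_eq, Set.mem_sdiff,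
      Set.mem_singleton_iff, Sym2.congr_right]
  have hcard := Set.ncard_sdiff_singleton_add_one (s := {m | g.Adj i m}) (a := j) hij
    (Set.toFinite _)
  rw [← hset] at hcard
  exact hcard

theorem delE_comm {n : ℕ} (g : SimpleGraph (Fin n)) (i j : Fin n) : delE g i j = delE g j i := by
  rw [delE, delE, Sym2.eq_swap]

theorem degree'_delE_right {n : ℕ} {g : SimpleGraph (Fin n)} {i j : Fin n} (hij : g.Adj i j) :
    degree' (delE g i j) j + 1 = degree' g j := by
  rw [delE_comm]
  exact degree'_delE_left hij.symm

theorem degree'_delE_of_ne {n : ℕ} (g : SimpleGraph (Fin n)) {i j m : Fin n} (hi : m ≠ i)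
    (hj : m ≠ j) : degree' (delE g i j) m = degree' g m := by
  have hset : {p | (delE g i j).Adj m p} = {p | g.Adj m p} := by
    ext p
    simp [delE, hi, hj]
  rw [degree', degree', hset]

/-- At the Cournot equilibrium, the markup of a firm equals its quantity. -/
theorem profitAt_eq_sq {n : ℕ} {V : Type*} [Fintype V] (αl : V → ℝ) (γ₀ : ℝ)
    (s : V → Fin n → ℝ) (f : ℝ → ℝ) (k : Fin n → ℕ) (g : SimpleGraph (Fin n)) (l : V)
    (i : Fin n) : profitAt αl γ₀ s f k g l i = dq αl γ₀ s f k g l i ^ 2 := by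
  have hn : (n : ℝ) + 1 ≠ 0 := by positivity
  set t : Fin n → ℝ := fun m => s l m + f ((degree' g m : ℝ) - (k m : ℝ)) with ht
  have hdq : ∀ m, dq αl γ₀ s f k g l m = (αl l - γ₀ + ∑ p, t p) / (n + 1) - t m := by
    intro m
    rw [← Finset.add_sum_erase univ t (Finset.mem_univ m), dq]
    simp only [ht]
    field_simp
    ring
  have hmarkup : priceAt αl γ₀ s f k g l - cost γ₀ f k g i - s l i = dq αl γ₀ s f k g l i := by
    rw [priceAt, cost, Finset.sum_congr rfl fun m _ => hdq m, hdq i, Finset.sum_sub_distrib,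
      Finset.sum_const, Finset.card_univ, Fintype.card_fin, nsmul_eq_mul,
      show t i = s l i + f ((degree' g i : ℝ) - (k i : ℝ)) from rfl]
    field_simp
    ring
  rw [profitAt, hmarkup, sq]

/-- under condition (⋆⋆), no firm gains total profit by deleting a link. -/
theorem stmt16 (n : ℕ) (hn : 2 ≤ n) (V : Type*) [Fintype V] (αl : V → ℝ) (γ₀ : ℝ)
    (s : V → Fin n → ℝ) (hs : ∀ l i, 0 ≤ s l i) (f : ℝ → ℝ)
    (hconv : ConvexOn ℝ Set.univ f) (hf0 : ∀ x, 0 ≤ f x) (hfmin : ∀ x, f 0 ≤ f x)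
    (k : Fin n → ℕ) (hk : ∀ i, k i ≤ n - 1)
    (M : ℝ) (hM : IsGreatest (Set.range fun p : V × Fin n => s p.1 p.2) M)
    (hstar : ∀ l : V, 0 < αl l - γ₀ - n * (M + max (f ((n : ℝ) - 1)) (f (1 - (n : ℝ))))
      - (((n : ℝ) - 1) / 2) * max (f 1 - f 0) (f (-1) - f 0))
    (g : SimpleGraph (Fin n)) (hdeg : ∀ i, degree' g i = k i)
    (i j : Fin n) (hij : g.Adj i j) :
    totProfit αl γ₀ s f k (delE g i j) i ≤ totProfit αl γ₀ s f k g i := by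
  have hn1 : (1 : ℝ) ≤ n := by exact_mod_cast (by omega : 1 ≤ n)
  have hki : (degree' (delE g i j) i : ℝ) - k i = -1 := by
    rw [← hdeg i, ← degree'_delE_left hij]
    push_cast
    ring
  have hkj : (degree' (delE g i j) j : ℝ) - k j = -1 := by
    rw [← hdeg j, ← degree'_delE_right hij]
    push_cast
    ring
  have hjmem : j ∈ univ.erase i := Finset.mem_erase.2 ⟨hij.ne', Finset.mem_univ j⟩
  refine Finset.sum_le_sum fun l _ => ?_
  rw [profitAt_eq_sq, profitAt_eq_sq]
  have hdq : dq αl γ₀ s f k g l i =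
      (αl l - γ₀ - n * (s l i + f 0) + ∑ m ∈ univ.erase i, (s l m + f 0)) / (n + 1) := by
    simp only [dq, hdeg, sub_self]
  have hsum : ∑ m ∈ univ.erase i, (s l m + f ((degree' (delE g i j) m : ℝ) - k m)) =
      ∑ m ∈ univ.erase i, (s l m + f 0) + (f (-1) - f 0) := by
    rw [← Finset.add_sum_erase _ _ hjmem, ← Finset.add_sum_erase _ (fun m => s l m + f 0) hjmem,
      hkj]
    have hrest : ∀ m ∈ (univ.erase i).erase j,
        s l m + f ((degree' (delE g i j) m : ℝ) - k m) = s l m + f 0 := by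
      intro m hm
      obtain ⟨hmj, hm⟩ := Finset.mem_erase.1 hm
      rw [degree'_delE_of_ne g (Finset.ne_of_mem_erase hm) hmj, hdeg, sub_self]
    rw [Finset.sum_congr rfl hrest]
    ring
  have hdq' : dq αl γ₀ s f k (delE g i j) l i =
      dq αl γ₀ s f k g l i - (n - 1) * (f (-1) - f 0) / (n + 1) := by
    rw [hdq, dq, hsum, hki]
    field_simp
    ring
  have hloss : 0 ≤ (n - 1) * (f (-1) - f 0) / ((n : ℝ) + 1) :=
    div_nonneg (mul_nonneg (by linarith) (sub_nonneg.2 (hfmin _))) (by linarith)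
  have hmean : (n - 1) * (f (-1) - f 0) / ((n : ℝ) + 1) ≤ 2 * dq αl γ₀ s f k g l i := by
    rw [hdq, ← mul_div_assoc]
    refine div_le_div_of_nonneg_right ?_ (by linarith)
    have hothers : 0 ≤ ∑ m ∈ univ.erase i, (s l m + f 0) :=
      Finset.sum_nonneg fun m _ => add_nonneg (hs l m) (hf0 0)
    have hown : n * (s l i + f 0) ≤ n * (M + max (f ((n : ℝ) - 1)) (f (1 - (n : ℝ)))) := by
      gcongr
      · exact hM.2 ⟨(l, i), rfl⟩
      · exact (hfmin _).trans (le_max_left _ _)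
    have hgap : ((n : ℝ) - 1) / 2 * (f (-1) - f 0) ≤
        ((n : ℝ) - 1) / 2 * max (f 1 - f 0) (f (-1) - f 0) :=
      mul_le_mul_of_nonneg_left (le_max_right _ _) (by linarith)
    linarith [hstar l]
  rw [hdq']
  nlinarith [mul_nonneg hloss (sub_nonneg.2 hmean)]
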